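/- Let v₁, …, v₅ ∈ ℂ³ ⊗ ℂ³ be five mutually orthogonal unit vectors, each of which is a product vector (v_i = a_i ⊗ b_i for some a_i, b_i ∈ ℂ³). Let ρ = (1/4)·(I − Σ_{i=1}^5 v_i v_i†), and for p ∈ [0,1] let ρ_p = (p/9)·I + (1−p)·ρ. Then: (1) ρ_p is absolutely PPT if and only if p ≥ 9(10 − √17)/83; and (2) if p ≥ 1 − 1/√10 then ρ_p is absolutely separable. -/

import Mathlib

open Matrix BigOperators
open scoped ComplexOrder

noncomputable section

/-- The partial transpose (on the second factor) of a matrix indexed by `Fin m × Fin n`. -/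
def partialTranspose {m n : ℕ} (X : Matrix (Fin m × Fin n) (Fin m × Fin n) ℂ) :
    Matrix (Fin m × Fin n) (Fin m × Fin n) ℂ :=
  Matrix.of fun p q => X (p.1, q.2) (q.1, p.2)

/-- A state is absolutely PPT if every unitary conjugate has positive semidefinite
partial transpose. -/
def AbsolutelyPPT {m n : ℕ} (ρ : Matrix (Fin m × Fin n) (Fin m × Fin n) ℂ) : Prop :=
  ∀ U : Matrix (Fin m × Fin n) (Fin m × Fin n) ℂ,
    U ∈ Matrix.unitaryGroup (Fin m × Fin n) ℂ →
      (partialTranspose (U * ρ * Uᴴ)).PosSemidef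

/-- A matrix is separable if it is a finite sum of Kronecker products of
positive semidefinite matrices. -/
def Separable {m n : ℕ} (σ : Matrix (Fin m × Fin n) (Fin m × Fin n) ℂ) : Prop :=
  ∃ (k : ℕ) (A : Fin k → Matrix (Fin m) (Fin m) ℂ) (B : Fin k → Matrix (Fin n) (Fin n) ℂ),
    (∀ i, (A i).PosSemidef) ∧ (∀ i, (B i).PosSemidef) ∧
      σ = ∑ i, Matrix.kroneckerMap (· * ·) (A i) (B i)

/-- A state is absolutely separable if every unitary conjugate of it is separable. -/
def AbsolutelySeparable {m n : ℕ} (ρ : Matrix (Fin m × Fin n) (Fin m × Fin n) ℂ) : Prop :=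
  ∀ U : Matrix (Fin m × Fin n) (Fin m × Fin n) ℂ,
    U ∈ Matrix.unitaryGroup (Fin m × Fin n) ℂ →
      Separable (U * ρ * Uᴴ)



/-- A family of vectors that is orthonormal along `s` consists of columns of a unitary matrix. -/
theorem exists_unitary_with_columns {ι : Type*} [Fintype ι] [DecidableEq ι] (s : Set ι)
    (v : ι → ι → ℂ)
    (hv : ∀ i ∈ s, ∀ j ∈ s, (∑ q, star (v i q) * v j q) = if i = j then (1 : ℂ) else 0) :
    ∃ U ∈ Matrix.unitaryGroup ι ℂ, ∀ i ∈ s, ∀ q, U q i = v i q := by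
  have hon : Orthonormal ℂ (s.domRestrict fun i => (WithLp.toLp 2 (v i) : EuclideanSpace ℂ ι)) := by
    classical
    rw [orthonormal_iff_ite]
    rintro ⟨i, hi⟩ ⟨j, hj⟩
    have := hv i hi j hj
    simpa [PiLp.inner_apply, mul_comm] using this
  obtain ⟨b, hb⟩ := hon.exists_orthonormalBasis_extension_of_card_eq (by simp)
  refine ⟨Matrix.of fun q i => b i q, ?_, fun i hi q => ?_⟩
  · rw [Matrix.mem_unitaryGroup_iff']
    ext i j
    have := orthonormal_iff_ite.1 b.orthonormal i j
    simpa [Matrix.mul_apply, Matrix.one_apply, PiLp.inner_apply, mul_comm] using this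
  · simp [hb i hi]

theorem exists_unitary_map_orthonormal {ι κ : Type*} [Fintype ι] [DecidableEq ι] [DecidableEq κ]
    (e : κ ↪ ι) (v w : κ → ι → ℂ)
    (hv : ∀ i j, (∑ q, star (v i q) * v j q) = if i = j then (1 : ℂ) else 0)
    (hw : ∀ i j, (∑ q, star (w i q) * w j q) = if i = j then (1 : ℂ) else 0) :
    ∃ U ∈ Matrix.unitaryGroup ι ℂ, ∀ i, U *ᵥ v i = w i := by
  have key : ∀ v : κ → ι → ℂ,
      (∀ i j, (∑ q, star (v i q) * v j q) = if i = j then (1 : ℂ) else 0) →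
      ∃ U ∈ Matrix.unitaryGroup ι ℂ, ∀ i, U *ᵥ Pi.single (e i) 1 = v i := by
    intro v hv
    obtain ⟨U, hU, h⟩ := exists_unitary_with_columns (Set.range e)
      (Function.extend e v 0) (by
        rintro _ ⟨i, rfl⟩ _ ⟨j, rfl⟩
        simpa [e.injective.extend_apply] using hv i j)
    refine ⟨U, hU, fun i => ?_⟩
    ext q
    simpa [e.injective.extend_apply] using h (e i) ⟨i, rfl⟩ q
  obtain ⟨V, hV, hVv⟩ := key v hv
  obtain ⟨W, hW, hWw⟩ := key w hw
  refine ⟨W * star V, mul_mem hW (Unitary.star_mem hV), fun i => ?_⟩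
  rw [← hVv i, Matrix.mulVec_mulVec, Matrix.mul_assoc, Matrix.mem_unitaryGroup_iff'.1 hV, mul_one,
    hWw]

/-- Singular value decomposition of a square complex matrix. -/
theorem exists_svd {ι : Type*} [Fintype ι] [DecidableEq ι] (C : Matrix ι ι ℂ) :
    ∃ A ∈ Matrix.unitaryGroup ι ℂ, ∃ B ∈ Matrix.unitaryGroup ι ℂ, ∃ s : ι → ℝ, (∀ i, 0 ≤ s i) ∧
      C = A * Matrix.diagonal (fun i => (s i : ℂ)) * B := by
  have hC := Matrix.posSemidef_conjTranspose_mul_self C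
  set V := hC.1.eigenvectorUnitary with hV
  set s : ι → ℝ := fun i => Real.sqrt (hC.1.eigenvalues i) with hs
  have hs2 : ∀ i, s i * s i = hC.1.eigenvalues i := fun i => Real.mul_self_sqrt (hC.eigenvalues_nonneg i)
  have hVV : star (V : Matrix ι ι ℂ) * V = 1 := Matrix.mem_unitaryGroup_iff'.1 V.2
  have hVV' : (V : Matrix ι ι ℂ) * star (V : Matrix ι ι ℂ) = 1 := Matrix.mem_unitaryGroup_iff.1 V.2
  have hY : (C * V.1)ᴴ * (C * V.1) = Matrix.diagonal (fun i => (s i : ℂ) * s i) := by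
    have h := hC.1.spectral_theorem
    rw [Unitary.conjStarAlgAut_apply] at h
    have h2 : (C * V.1)ᴴ * (C * V.1) = star (V : Matrix ι ι ℂ) * (Cᴴ * C) * V.1 := by
      simp [Matrix.conjTranspose_mul, Matrix.mul_assoc, Matrix.star_eq_conjTranspose]
    rw [h2, h, ← hV]
    calc _ = (star (V : Matrix ι ι ℂ) * V.1) * Matrix.diagonal (RCLike.ofReal ∘ hC.1.eigenvalues)
          * (star (V : Matrix ι ι ℂ) * V.1) := by simp only [Matrix.mul_assoc]
      _ = _ := by
        rw [hVV, one_mul, mul_one]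
        congr 1
        ext i
        simp [← hs2]
  have hY' : ∀ i j, ∑ q, star ((C * V.1 : Matrix ι ι ℂ) q i) * (C * V.1 : Matrix ι ι ℂ) q j
      = if i = j then (s i : ℂ) * s i else 0 := by
    intro i j
    have := congrFun (congrFun hY i) j
    rwa [Matrix.mul_apply, Matrix.diagonal_apply] at this
  obtain ⟨A, hA, hAs⟩ := exists_unitary_with_columns {i | s i ≠ 0}
    (fun i q => (s i : ℂ)⁻¹ * (C * V.1 : Matrix ι ι ℂ) q i) (by
      intro i hi j hj
      have hi' : (s i : ℂ) ≠ 0 := by exact_mod_cast hi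
      have : ∑ q, star ((s i : ℂ)⁻¹ * (C * V.1 : Matrix ι ι ℂ) q i) *
          ((s j : ℂ)⁻¹ * (C * V.1 : Matrix ι ι ℂ) q j) = (s i : ℂ)⁻¹ * (s j : ℂ)⁻¹ *
          ∑ q, star ((C * V.1 : Matrix ι ι ℂ) q i) * (C * V.1 : Matrix ι ι ℂ) q j := by
        rw [Finset.mul_sum]
        refine Finset.sum_congr rfl fun q _ => ?_
        simp only [star_mul', star_inv₀, Complex.star_def, Complex.conj_ofReal]
        ring
      rw [this, hY']
      split_ifs with h
      · subst h; field_simp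
      · simp)
  refine ⟨A, hA, star V.1, Unitary.star_mem V.2, s, fun i => Real.sqrt_nonneg _, ?_⟩
  have : A * Matrix.diagonal (fun i => (s i : ℂ)) = C * V.1 := by
    ext q i
    rw [Matrix.mul_diagonal]
    by_cases h : s i = 0
    · have h0 := hY' i i
      simp only [h, if_true, Complex.ofReal_zero, mul_zero] at h0 ⊢
      rw [Finset.sum_eq_zero_iff_of_nonneg (fun q _ => star_mul_self_nonneg _)] at h0
      have h1 : (C * V.1) q i = 0 := by simpa using h0 q (Finset.mem_univ q)
      simp [h1]
    · have h' : (s i : ℂ) ≠ 0 := by exact_mod_cast h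
      rw [hAs i h]
      field_simp
  rw [this, Matrix.mul_assoc, hVV', mul_one]

theorem partialTranspose_isHermitian {m n : ℕ} {X : Matrix (Fin m × Fin n) (Fin m × Fin n) ℂ}
    (hX : X.IsHermitian) : (partialTranspose X).IsHermitian := by
  ext p q
  exact hX.apply _ _

theorem sum_comm_six {α M : Type*} [Fintype α] [AddCommMonoid M] (F : α → α → α → α → α → α → M) :
    ∑ i, ∑ k, ∑ j, ∑ l, ∑ r, ∑ t, F i k j l r t = ∑ r, ∑ t, ∑ j, ∑ k, ∑ i, ∑ l, F i k j l r t := by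
  let e : (α × α) × (α × α) × (α × α) ≃ (α × α) × (α × α) × (α × α) :=
    ⟨fun z => (z.2.2, (z.2.1.1, z.1.2), (z.1.1, z.2.1.2)),
      fun z => ((z.2.2.1, z.2.1.2), (z.2.1.1, z.2.2.2), z.1), fun _ => rfl, fun _ => rfl⟩
  have h := Fintype.sum_equiv e
    (fun z => F z.1.1 z.1.2 z.2.1.1 z.2.1.2 z.2.2.1 z.2.2.2)
    (fun z => F z.2.2.1 z.2.1.2 z.2.1.1 z.2.2.2 z.1.1 z.1.2) fun _ => rfl
  simpa only [Fintype.sum_prod_type] using h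

/-- The quadratic form of a partial transpose at a vector given by its Schmidt decomposition. -/
theorem partialTranspose_quadForm_svd {n : ℕ} (Q : Matrix (Fin n × Fin n) (Fin n × Fin n) ℂ)
    (A B : Matrix (Fin n) (Fin n) ℂ) (s : Fin n → ℝ) (x : Fin n × Fin n → ℂ)
    (hx : ∀ i k, x (i, k) = ∑ r, A i r * s r * B r k) :
    star x ⬝ᵥ (partialTranspose Q *ᵥ x) =
      ∑ r, ∑ t, (s r * s t : ℂ) * ((Matrix.kroneckerMap (· * ·) A Bᴴ)ᴴ * Q *
        Matrix.kroneckerMap (· * ·) A Bᴴ) (r, t) (t, r) := by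
  have hl : star x ⬝ᵥ (partialTranspose Q *ᵥ x) = ∑ i, ∑ k, ∑ j, ∑ l, ∑ r, ∑ t,
      s r * s t * star (A i r) * star (B r k) * Q (i, l) (j, k) * A j t * B t l := by
    simp only [dotProduct, Matrix.mulVec, Fintype.sum_prod_type, partialTranspose,
      Matrix.of_apply, Pi.star_apply, hx, star_sum, star_mul', Complex.star_def,
      Complex.conj_ofReal, Finset.mul_sum, Finset.sum_mul]
    refine Finset.sum_congr rfl fun i _ => Finset.sum_congr rfl fun k _ =>
      Finset.sum_congr rfl fun j _ => Finset.sum_congr rfl fun l _ => ?_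
    refine Finset.sum_comm.trans (Finset.sum_congr rfl fun r _ => Finset.sum_congr rfl fun t _ => ?_)
    ring
  rw [hl, sum_comm_six]
  simp only [Matrix.mul_apply, Fintype.sum_prod_type, Matrix.conjTranspose_apply,
    Matrix.kroneckerMap_apply, star_mul', Complex.star_def, Finset.mul_sum, Finset.sum_mul,
    Complex.conj_conj]
  refine Finset.sum_congr rfl fun r _ => Finset.sum_congr rfl fun t _ =>
    Finset.sum_congr rfl fun j _ => Finset.sum_congr rfl fun k _ =>
    Finset.sum_congr rfl fun i _ => Finset.sum_congr rfl fun l _ => ?_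
  ring

/-- Lower bound on the symmetrised sum for a family of weights of total mass four. -/
theorem schmidt_weight_bound (s w : Fin 3 → ℝ) (u v : Fin 3 → ℝ) (τ : ℝ) (hτ : 0 ≤ τ)
    (hτ2 : 2 * τ ^ 2 + τ = 2)
    (hs : ∀ i, 0 ≤ s i) (hw : ∀ i, 0 ≤ w i) (hu : ∀ i, 0 ≤ u i) (hv : ∀ i, v i ≤ 1)
    (htot : ∑ i, w i + ∑ i, u i + ∑ i, v i = 4) :
    -τ * ∑ i, s i ^ 2 ≤ ∑ i, s i ^ 2 * w i + s 0 * s 1 * (u 0 - v 0) + s 0 * s 2 * (u 1 - v 1)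
      + s 1 * s 2 * (u 2 - v 2) := by
  have quad : ∀ a b c : ℝ, 0 ≤ τ * (a ^ 2 + b ^ 2 + c ^ 2) + c ^ 2 - a * b - a * c - b * c := by
    intro a b c
    have h1 : 0 < 2 * τ - 1 := by nlinarith
    have : 4 * (2 * τ - 1) * (τ * (a ^ 2 + b ^ 2 + c ^ 2) + c ^ 2 - a * b - a * c - b * c)
        = ((2 * τ - 1) * (a + b) - 2 * c) ^ 2 + (2 * τ - 1) * (2 * τ + 1) * (a - b) ^ 2 := by
      linear_combination (4 * c ^ 2) * hτ2
    refine nonneg_of_mul_nonneg_right (a := 4 * (2 * τ - 1)) ?_ (by positivity)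
    rw [this]
    positivity
  simp only [Fin.sum_univ_three] at *
  have h01 := mul_nonneg (hs 0) (hs 1)
  have h02 := mul_nonneg (hs 0) (hs 2)
  have h12 := mul_nonneg (hs 1) (hs 2)
  have main : ∀ m : ℝ, 0 ≤ m → m ≤ s 0 ^ 2 → m ≤ s 1 ^ 2 → m ≤ s 2 ^ 2 → m ≤ s 0 * s 1 →
      m ≤ s 0 * s 2 → m ≤ s 1 * s 2 →
      m - s 0 * s 1 - s 0 * s 2 - s 1 * s 2 ≤ s 0 ^ 2 * w 0 + s 1 ^ 2 * w 1 + s 2 ^ 2 * w 2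
        + s 0 * s 1 * (u 0 - v 0) + s 0 * s 2 * (u 1 - v 1) + s 1 * s 2 * (u 2 - v 2) := by
    intro m hm h0 h1 h2 h3 h4 h5
    have := mul_le_mul_of_nonneg_right h0 (hw 0)
    have := mul_le_mul_of_nonneg_right h1 (hw 1)
    have := mul_le_mul_of_nonneg_right h2 (hw 2)
    have := mul_le_mul_of_nonneg_right h3 (hu 0)
    have := mul_le_mul_of_nonneg_right h4 (hu 1)
    have := mul_le_mul_of_nonneg_right h5 (hu 2)
    have := mul_le_mul_of_nonneg_left (hv 0) (add_nonneg hm h01)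
    have := mul_le_mul_of_nonneg_left (hv 1) (add_nonneg hm h02)
    have := mul_le_mul_of_nonneg_left (hv 2) (add_nonneg hm h12)
    have e := congrArg (m * ·) htot
    nlinarith
  have sq_le : ∀ {a b c : ℝ}, 0 ≤ a → a ≤ b → a ≤ c → a ^ 2 ≤ b * c := fun ha hb hc => by
    rw [sq]
    exact mul_le_mul hb hc ha (ha.trans hb)
  have q0 := quad (s 1) (s 2) (s 0)
  have q1 := quad (s 0) (s 2) (s 1)
  have q2 := quad (s 0) (s 1) (s 2)
  have min0 : s 0 ≤ s 1 → s 0 ≤ s 2 → _ := fun h h' => main (s 0 ^ 2) (sq_nonneg _) le_rfl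
    (pow_le_pow_left₀ (hs 0) h 2) (pow_le_pow_left₀ (hs 0) h' 2) (sq_le (hs 0) le_rfl h)
    (sq_le (hs 0) le_rfl h') (sq_le (hs 0) h h')
  have min1 : s 1 ≤ s 0 → s 1 ≤ s 2 → _ := fun h h' => main (s 1 ^ 2) (sq_nonneg _)
    (pow_le_pow_left₀ (hs 1) h 2) le_rfl (pow_le_pow_left₀ (hs 1) h' 2) (sq_le (hs 1) h le_rfl)
    (sq_le (hs 1) h h') (sq_le (hs 1) le_rfl h')
  have min2 : s 2 ≤ s 0 → s 2 ≤ s 1 → _ := fun h h' => main (s 2 ^ 2) (sq_nonneg _)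
    (pow_le_pow_left₀ (hs 2) h 2) (pow_le_pow_left₀ (hs 2) h' 2) le_rfl (sq_le (hs 2) h h')
    (sq_le (hs 2) h le_rfl) (sq_le (hs 2) h' le_rfl)
  rcases le_total (s 0) (s 1) with h | h
  · rcases le_total (s 0) (s 2) with h' | h'
    · linarith [min0 h h']
    · linarith [min2 h' (h'.trans h)]
  · rcases le_total (s 1) (s 2) with h' | h'
    · linarith [min1 h h']
    · linarith [min2 (h'.trans h) h']

theorem Matrix.PosSemidef.re_add_nonneg {ι : Type*} [Fintype ι] [DecidableEq ι] {X : Matrix ι ι ℂ}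
    (hX : X.PosSemidef) (p q : ι) :
    0 ≤ (X p p).re + (X q q).re + 2 * (X p q).re ∧ 0 ≤ (X p p).re + (X q q).re - 2 * (X p q).re := by
  have hqp : (X q p).re = (X p q).re := by rw [← hX.1.apply q p]; simp
  have key : ∀ c : ℝ, 0 ≤ (X p p).re + c * (X p q).re + c * ((X p q).re + c * (X q q).re) := by
    intro c
    have := (Complex.le_def.1 (hX.dotProduct_mulVec_nonneg
      (Pi.single p 1 + (c : ℂ) • Pi.single q 1))).1
    rw [mul_add]
    simpa [add_dotProduct, Matrix.mulVec_add, Matrix.mulVec_smul, hqp, star_add] using this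
  constructor
  · linarith [key 1]
  · linarith [key (-1)]

theorem Matrix.IsHermitian.posSemidef_of_idempotent {ι : Type*} [Fintype ι] {P : Matrix ι ι ℂ}
    (hP : P.IsHermitian) (hP2 : P * P = P) : P.PosSemidef := by
  have := Matrix.posSemidef_conjTranspose_mul_self P
  rwa [hP.eq, hP2] at this

theorem projection_swap_form_bound {Q : Matrix (Fin 3 × Fin 3) (Fin 3 × Fin 3) ℂ}
    (hQ : Q.IsHermitian) (hQ2 : Q * Q = Q) (htr : Q.trace = 4) {s : Fin 3 → ℝ} (hs : ∀ i, 0 ≤ s i)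
    {τ : ℝ} (hτ : 0 ≤ τ) (hτ2 : 2 * τ ^ 2 + τ = 2) :
    -τ * ∑ i, s i ^ 2 ≤ (∑ r, ∑ t, (s r * s t : ℂ) * Q (r, t) (t, r)).re := by
  have h0 := hQ.posSemidef_of_idempotent hQ2
  have h1 : (1 - Q).PosSemidef := by
    refine Matrix.IsHermitian.posSemidef_of_idempotent (Matrix.isHermitian_one.sub hQ) ?_
    rw [mul_sub, sub_mul, sub_mul, hQ2]
    simp
  have hw : ∀ i : Fin 3, 0 ≤ (Q (i, i) (i, i)).re := fun i => (Complex.le_def.1 (h0.diag_nonneg)).1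
  have hqp : ∀ p q, (Q q p).re = (Q p q).re := fun p q => by rw [← hQ.apply q p]; simp
  have hu := fun i j : Fin 3 => (h0.re_add_nonneg (i, j) (j, i)).1
  have hv := fun i j : Fin 3 => (h1.re_add_nonneg (i, j) (j, i)).2
  have htr' := congrArg Complex.re htr
  simp only [Matrix.trace, Matrix.diag, Fintype.sum_prod_type, Fin.sum_univ_three, Complex.add_re,
    Complex.re_ofNat] at htr'
  have := schmidt_weight_bound s (fun i => (Q (i, i) (i, i)).re)
    ![((Q (0, 1) (0, 1)).re + (Q (1, 0) (1, 0)).re) / 2 + (Q (0, 1) (1, 0)).re,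
      ((Q (0, 2) (0, 2)).re + (Q (2, 0) (2, 0)).re) / 2 + (Q (0, 2) (2, 0)).re,
      ((Q (1, 2) (1, 2)).re + (Q (2, 1) (2, 1)).re) / 2 + (Q (1, 2) (2, 1)).re]
    ![((Q (0, 1) (0, 1)).re + (Q (1, 0) (1, 0)).re) / 2 - (Q (0, 1) (1, 0)).re,
      ((Q (0, 2) (0, 2)).re + (Q (2, 0) (2, 0)).re) / 2 - (Q (0, 2) (2, 0)).re,
      ((Q (1, 2) (1, 2)).re + (Q (2, 1) (2, 1)).re) / 2 - (Q (1, 2) (2, 1)).re]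
    τ hτ hτ2 hs hw
    (by
      intro i
      fin_cases i
      · have := hu 0 1
        simp; linarith
      · have := hu 0 2
        simp; linarith
      · have := hu 1 2
        simp; linarith)
    (by
      intro i
      fin_cases i
      · have := hv 0 1
        simp at this ⊢; linarith
      · have := hv 0 2
        simp at this ⊢; linarith
      · have := hv 1 2
        simp at this ⊢; linarith)
    (by
      simp [Fin.sum_univ_three]
      linarith)
  refine this.trans (le_of_eq ?_)
  simp only [Fin.sum_univ_three, Complex.add_re, ← Complex.ofReal_mul, Complex.re_ofReal_mul]
  simp [hqp (0, 1) (1, 0), hqp (0, 2) (2, 0), hqp (1, 2) (2, 1)]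
  ring

theorem partialTranspose_posSemidef_of_projection {P : Matrix (Fin 3 × Fin 3) (Fin 3 × Fin 3) ℂ}
    (hP : P.IsHermitian) (hP2 : P * P = P) (htr : P.trace = 4) {b d τ : ℝ} (hd : 0 ≤ d)
    (hτ : 0 ≤ τ) (hτ2 : 2 * τ ^ 2 + τ = 2) (hb : τ * d ≤ b) :
    (partialTranspose ((b : ℂ) • (1 : Matrix (Fin 3 × Fin 3) (Fin 3 × Fin 3) ℂ)
      + (d : ℂ) • P)).PosSemidef := by
  set σ := (b : ℂ) • (1 : Matrix (Fin 3 × Fin 3) (Fin 3 × Fin 3) ℂ) + (d : ℂ) • P with hσ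
  have hσH : σ.IsHermitian := by
    simp [Matrix.IsHermitian, hσ, hP.eq]
  have hH := partialTranspose_isHermitian hσH
  refine Matrix.PosSemidef.of_dotProduct_mulVec_nonneg hH fun x => ?_
  refine Complex.le_def.2 ⟨?_, (hH.im_star_dotProduct_mulVec_self x).symm⟩
  obtain ⟨A, hA, B, hB, s, hs, h⟩ := exists_svd (Matrix.of fun i k => x (i, k))
  have hx : ∀ i k, x (i, k) = ∑ r, A i r * s r * B r k := by
    intro i k
    have := congrFun (congrFun h i) k
    rw [Matrix.mul_apply, Matrix.of_apply] at this
    simpa only [Matrix.mul_diagonal] using this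
  rw [partialTranspose_quadForm_svd σ A B s x hx]
  set T := Matrix.kroneckerMap (· * ·) A Bᴴ with hT
  have hTu : T ∈ Matrix.unitaryGroup (Fin 3 × Fin 3) ℂ :=
    Matrix.kronecker_mem_unitary hA (Unitary.star_mem hB)
  have hT1 : Tᴴ * T = 1 := Matrix.mem_unitaryGroup_iff'.1 hTu
  have hT2 : T * Tᴴ = 1 := Matrix.mem_unitaryGroup_iff.1 hTu
  have hσT : Tᴴ * σ * T = (b : ℂ) • (1 : Matrix (Fin 3 × Fin 3) (Fin 3 × Fin 3) ℂ)
      + (d : ℂ) • (Tᴴ * P * T) := by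
    simp [hσ, mul_add, add_mul, hT1]
  have hQ := projection_swap_form_bound (Q := Tᴴ * P * T) (Matrix.isHermitian_conjTranspose_mul_mul T hP)
    (by
      calc Tᴴ * P * T * (Tᴴ * P * T) = Tᴴ * P * (T * Tᴴ) * P * T := by simp only [Matrix.mul_assoc]
        _ = _ := by rw [hT2, mul_one, Matrix.mul_assoc Tᴴ, hP2])
    (by rw [Matrix.trace_mul_cycle, hT2, one_mul, htr]) hs hτ hτ2
  have e : (∑ r, ∑ t, (s r * s t : ℂ) * (Tᴴ * σ * T) (r, t) (t, r)).re = b * ∑ i, s i ^ 2 +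
      d * (∑ r, ∑ t, (s r * s t : ℂ) * (Tᴴ * P * T) (r, t) (t, r)).re := by
    rw [hσT]
    simp only [Fin.sum_univ_three, Complex.add_re, ← Complex.ofReal_mul, Complex.re_ofReal_mul,
      Matrix.add_apply, Matrix.smul_apply, smul_eq_mul, Matrix.one_apply]
    simp
    ring
  rw [e]
  have h1 := mul_le_mul_of_nonneg_left hQ hd
  have h2 := mul_le_mul_of_nonneg_right hb (Finset.sum_nonneg fun i (_ : i ∈ Finset.univ) => sq_nonneg (s i))
  simp only [Complex.zero_re]
  nlinarith

theorem sum_vecMulVec_isHermitian {ι κ : Type*} [Fintype κ] (v : κ → ι → ℂ) :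
    (∑ i, Matrix.vecMulVec (v i) (star (v i))).IsHermitian := by
  simp [Matrix.IsHermitian, Matrix.conjTranspose_sum, Matrix.conjTranspose_vecMulVec]

theorem sum_vecMulVec_mul_self {ι κ : Type*} [Fintype ι] [Fintype κ] [DecidableEq κ] {v : κ → ι → ℂ}
    (hv : ∀ i j, (∑ q, star (v i q) * v j q) = if i = j then (1 : ℂ) else 0) :
    (∑ i, Matrix.vecMulVec (v i) (star (v i))) * (∑ i, Matrix.vecMulVec (v i) (star (v i))) =
      ∑ i, Matrix.vecMulVec (v i) (star (v i)) := by
  have h : ∀ i j, star (v i) ⬝ᵥ v j = if i = j then (1 : ℂ) else 0 := hv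
  simp [Finset.sum_mul, Finset.mul_sum, Matrix.vecMulVec_mul_vecMulVec, h, ite_smul,
    apply_ite (Matrix.vecMulVec _)]

theorem trace_sum_vecMulVec {ι κ : Type*} [Fintype ι] [Fintype κ] [DecidableEq κ] {v : κ → ι → ℂ}
    (hv : ∀ i j, (∑ q, star (v i q) * v j q) = if i = j then (1 : ℂ) else 0) :
    (∑ i, Matrix.vecMulVec (v i) (star (v i))).trace = Fintype.card κ := by
  have h : ∀ i, v i ⬝ᵥ star (v i) = 1 := fun i => by
    rw [dotProduct_comm]; exact (hv i i).trans (if_pos rfl)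
  simp [Matrix.trace_sum, Matrix.trace_vecMulVec, h]

theorem mul_vecMulVec_star_mul_conjTranspose {ι : Type*} [Fintype ι] (U : Matrix ι ι ℂ)
    (x : ι → ℂ) :
    U * Matrix.vecMulVec x (star x) * Uᴴ = Matrix.vecMulVec (U *ᵥ x) (star (U *ᵥ x)) := by
  rw [Matrix.mul_vecMulVec, Matrix.vecMulVec_mul, Matrix.star_mulVec]

/-- Five orthonormal vectors of `ℂ³ ⊗ ℂ³` whose complement is spanned by the antisymmetric vectors
and `e₂ ⊗ e₂`. -/
def extremalFamily : Fin 5 → Fin 3 × Fin 3 → ℂ :=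
  ![Pi.single (0, 0) 1, Pi.single (1, 1) 1,
    ((Real.sqrt 2)⁻¹ : ℂ) • (Pi.single (0, 1) 1 + Pi.single (1, 0) 1),
    ((Real.sqrt 2)⁻¹ : ℂ) • (Pi.single (0, 2) 1 + Pi.single (2, 0) 1),
    ((Real.sqrt 2)⁻¹ : ℂ) • (Pi.single (1, 2) 1 + Pi.single (2, 1) 1)]

theorem inv_sqrt_two_mul_self : ((Real.sqrt 2)⁻¹ : ℂ) * ((Real.sqrt 2)⁻¹ : ℂ) = 1 / 2 := by
  rw [← mul_inv, ← Complex.ofReal_mul, Real.mul_self_sqrt (by norm_num)]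
  norm_num

theorem extremalFamily_orthonormal (i j : Fin 5) :
    (∑ q, star (extremalFamily i q) * extremalFamily j q) = if i = j then (1 : ℂ) else 0 := by
  have h := inv_sqrt_two_mul_self
  fin_cases i <;> fin_cases j <;>
    simp [extremalFamily, Fintype.sum_prod_type, Fin.sum_univ_three, Pi.single_apply, h] <;>
    norm_num

theorem extremalFamily_quadForm (b d α β : ℝ) :
    let x : Fin 3 × Fin 3 → ℂ := fun p => if p.1 = p.2 then ![(α : ℂ), α, β] p.1 else 0
    (star x ⬝ᵥ (partialTranspose ((b : ℂ) • (1 : Matrix (Fin 3 × Fin 3) (Fin 3 × Fin 3) ℂ)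
      + (d : ℂ) • (1 - ∑ i, Matrix.vecMulVec (extremalFamily i) (star (extremalFamily i)))) *ᵥ x)) =
      ((b * (2 * α ^ 2 + β ^ 2) + d * (β ^ 2 - α ^ 2 - 2 * α * β) : ℝ) : ℂ) := by
  intro x
  have h := inv_sqrt_two_mul_self
  simp [x, dotProduct, Matrix.mulVec, Fintype.sum_prod_type, Fin.sum_univ_three, Fin.sum_univ_five,
    partialTranspose, extremalFamily, Matrix.vecMulVec_apply, Matrix.one_apply,
    Pi.single_apply, h]
  ring

theorem le_of_absolutelyPPT {v : Fin 5 → Fin 3 × Fin 3 → ℂ}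
    (hv : ∀ i j, (∑ q, star (v i q) * v j q) = if i = j then (1 : ℂ) else 0) {b d : ℝ}
    (h : AbsolutelyPPT ((b : ℂ) • (1 : Matrix (Fin 3 × Fin 3) (Fin 3 × Fin 3) ℂ)
      + (d : ℂ) • (1 - ∑ i, Matrix.vecMulVec (v i) (star (v i))))) (α β : ℝ) :
    0 ≤ b * (2 * α ^ 2 + β ^ 2) + d * (β ^ 2 - α ^ 2 - 2 * α * β) := by
  obtain ⟨U, hU, hUv⟩ := exists_unitary_map_orthonormal
    (⟨fun i => finProdFinEquiv.symm (Fin.castLE (by norm_num) i), fun i j hij => by simpa using hij⟩ :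
      Fin 5 ↪ Fin 3 × Fin 3) v extremalFamily hv extremalFamily_orthonormal
  have hUU : U * Uᴴ = 1 := Matrix.mem_unitaryGroup_iff.1 hU
  have e : U * ((b : ℂ) • (1 : Matrix (Fin 3 × Fin 3) (Fin 3 × Fin 3) ℂ)
      + (d : ℂ) • (1 - ∑ i, Matrix.vecMulVec (v i) (star (v i)))) * Uᴴ =
      (b : ℂ) • (1 : Matrix (Fin 3 × Fin 3) (Fin 3 × Fin 3) ℂ)
      + (d : ℂ) • (1 - ∑ i, Matrix.vecMulVec (extremalFamily i) (star (extremalFamily i))) := by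
    simp only [mul_add, add_mul, mul_sub, sub_mul, Matrix.mul_smul, Matrix.smul_mul, mul_one, hUU,
      Finset.mul_sum, Finset.sum_mul, mul_vecMulVec_star_mul_conjTranspose, hUv]
  have := (h U hU).dotProduct_mulVec_nonneg
    (fun p => if p.1 = p.2 then ![(α : ℂ), α, β] p.1 else 0)
  rw [e, extremalFamily_quadForm] at this
  exact_mod_cast this

theorem IsCompact.convexHull_of_finiteDimensional {E : Type*} [AddCommGroup E] [Module ℝ E]
    [TopologicalSpace E] [IsTopologicalAddGroup E] [ContinuousSMul ℝ E] [FiniteDimensional ℝ E]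
    {K : Set E} (hK : IsCompact K) : IsCompact (convexHull ℝ K) := by
  rcases K.eq_empty_or_nonempty with rfl | ⟨k₀, hk₀⟩
  · simp
  let N := Module.finrank ℝ E + 1
  have himg : convexHull ℝ K = (fun z : (Fin N → ℝ) × (Fin N → E) => ∑ i, z.1 i • z.2 i) ''
      (stdSimplex ℝ (Fin N) ×ˢ Set.univ.pi fun _ => K) := by
    apply Set.Subset.antisymm
    · intro x hx
      obtain ⟨ι, _, z, w, hz, hind, hw, hw1, rfl⟩ := eq_pos_convex_span_of_mem_convexHull hx
      have hcard : Fintype.card ι ≤ Fintype.card (Fin N) := by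
        rw [Fintype.card_fin]
        exact hind.card_le_finrank_succ.trans
          (Nat.add_le_add_right (Submodule.finrank_le _) 1)
      obtain ⟨e⟩ := Function.Embedding.nonempty_of_card_le hcard
      refine ⟨(Function.extend e w 0, Function.extend e z fun _ => k₀), ⟨⟨fun j => ?_, ?_⟩, ?_⟩, ?_⟩
      · by_cases hj : ∃ i, e i = j
        · obtain ⟨i, rfl⟩ := hj
          simpa [e.injective.extend_apply] using (hw i).le
        · simp [Function.extend_apply' _ _ _ hj]
      · refine (Fintype.sum_of_injective e e.injective w _ (fun j hj => ?_) fun i => ?_).symm.trans hw1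
        · simp [Function.extend_apply' _ _ _ hj]
        · simp [e.injective.extend_apply]
      · intro j _
        by_cases hj : ∃ i, e i = j
        · obtain ⟨i, rfl⟩ := hj
          simpa [e.injective.extend_apply] using hz ⟨i, rfl⟩
        · simpa [Function.extend_apply' _ _ _ hj] using hk₀
      · refine (Fintype.sum_of_injective e e.injective _ _ (fun j hj => ?_) fun i => ?_).symm
        · simp [Function.extend_apply' _ _ _ hj]
        · simp [e.injective.extend_apply]
    · rintro _ ⟨⟨w, z⟩, ⟨hw, hz⟩, rfl⟩
      exact mem_convexHull_of_exists_fintype w z hw.1 hw.2 (fun i => hz i trivial) rfl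
  rw [himg]
  exact ((isCompact_stdSimplex ℝ _).prod (isCompact_univ_pi fun _ => hK)).image (by fun_prop)

theorem sum_normSq_fourth_roots (α β γ : ℂ) :
    ∑ t : Fin 4, Complex.normSq (α + Complex.I ^ (t : ℕ) * β + (-Complex.I) ^ (t : ℕ) * γ) =
      4 * (Complex.normSq α + Complex.normSq β + Complex.normSq γ) := by
  simp [Fin.sum_univ_four, pow_succ, Complex.normSq_apply]
  ring

/-- A weighted complex projective 2-design in `ℂ³` averages the squared modulus of the
quadratic form of a matrix. -/
theorem sum_normSq_quadForm_design (B : Matrix (Fin 3) (Fin 3) ℂ) :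
    ∑ s : Fin 4, ∑ t : Fin 4, Complex.normSq (star ![1, Complex.I ^ (s : ℕ), Complex.I ^ (t : ℕ)] ⬝ᵥ
        (B *ᵥ ![1, Complex.I ^ (s : ℕ), Complex.I ^ (t : ℕ)])) +
      16 * ∑ k, Complex.normSq (star (Pi.single k 1) ⬝ᵥ (B *ᵥ Pi.single k 1)) =
    16 * (Complex.normSq B.trace + ∑ k, ∑ l, Complex.normSq (B k l)) := by
  have hII : ∀ s : ℕ, (-Complex.I) ^ s * Complex.I ^ s = 1 := fun s => by
    rw [← mul_pow]; simp
  have expand : ∀ s t : ℕ, star ![1, Complex.I ^ s, Complex.I ^ t] ⬝ᵥ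
      (B *ᵥ ![1, Complex.I ^ s, Complex.I ^ t]) =
      (B.trace + Complex.I ^ s * B 0 1 + (-Complex.I) ^ s * B 1 0) +
      Complex.I ^ t * (B 0 2 + Complex.I ^ s * 0 + (-Complex.I) ^ s * B 1 2) +
      (-Complex.I) ^ t * (B 2 0 + Complex.I ^ s * B 2 1 + (-Complex.I) ^ s * 0) := by
    intro s t
    simp [dotProduct, Matrix.mulVec, Fin.sum_univ_three, Matrix.trace]
    linear_combination B 1 1 * hII s + B 2 2 * hII t
  simp only [expand, sum_normSq_fourth_roots, ← Finset.mul_sum, Finset.sum_add_distrib]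
  simp [Fin.sum_univ_three]
  ring

theorem Matrix.PosSemidef.sum_normSq_le {ι : Type*} [Fintype ι] {X : Matrix ι ι ℂ}
    (hX : X.PosSemidef) : ∑ i, ∑ j, Complex.normSq (X i j) ≤ Complex.normSq X.trace := by
  have hd : ∀ i, X i i = ((X i i).re : ℂ) := fun i =>
    Complex.ext rfl (by simpa using (Complex.le_def.1 (hX.diag_nonneg (i := i))).2.symm)
  have hmin : ∀ i j, Complex.normSq (X i j) ≤ (X i i).re * (X j j).re := by
    intro i j
    have h := (Complex.le_def.1 (hX.submatrix ![i, j]).det_nonneg).1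
    rw [Matrix.det_fin_two] at h
    have hji : X j i = star (X i j) := (hX.1.apply j i).symm
    simp only [Matrix.submatrix_apply, Matrix.cons_val_zero, Matrix.cons_val_one, hji,
      Complex.star_def, Complex.mul_conj] at h
    rw [hd i, hd j, ← Complex.ofReal_mul, ← Complex.ofReal_sub] at h
    simpa using h
  have htr : X.trace = ((∑ i, (X i i).re : ℝ) : ℂ) := by
    rw [Complex.ofReal_sum]
    exact Finset.sum_congr rfl fun i _ => hd i
  rw [htr, Complex.normSq_ofReal, Finset.sum_mul_sum]
  exact Finset.sum_le_sum fun i _ => Finset.sum_le_sum fun j _ => hmin i j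

/-- A Hermitian matrix is block positive if its quadratic form is nonnegative at product vectors. -/
def BlockPositive {m n : ℕ} (W : Matrix (Fin m × Fin n) (Fin m × Fin n) ℂ) : Prop :=
  W.IsHermitian ∧ ∀ (a : Fin m → ℂ) (b : Fin n → ℂ),
    0 ≤ (star (fun p : Fin m × Fin n => a p.1 * b p.2) ⬝ᵥ (W *ᵥ fun p => a p.1 * b p.2)).re

theorem BlockPositive.swap {m n : ℕ} {W : Matrix (Fin m × Fin n) (Fin m × Fin n) ℂ}
    (hW : BlockPositive W) : BlockPositive (W.submatrix Prod.swap Prod.swap) := by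
  refine ⟨hW.1.submatrix _, fun a b => ?_⟩
  have := hW.2 b a
  convert this using 2
  rw [← Equiv.coe_prodComm, Matrix.submatrix_mulVec_equiv]
  simp only [dotProduct]
  refine Fintype.sum_equiv (Equiv.prodComm _ _) _ _ fun p => ?_
  simp [mul_comm, Function.comp_def]

theorem BlockPositive.sum_normSq_le_add {W : Matrix (Fin 3 × Fin 3) (Fin 3 × Fin 3) ℂ}
    (hW : BlockPositive W) :
    ∑ i, ∑ j, (Complex.normSq (∑ k, W (i, k) (j, k)) + ∑ k, ∑ l, Complex.normSq (W (i, k) (j, l))) ≤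
      Complex.normSq W.trace + ∑ k, ∑ l, Complex.normSq (∑ i, W (i, k) (i, l)) := by
  let S : Fin 3 → Fin 3 → Matrix (Fin 3) (Fin 3) ℂ := fun i j => Matrix.of fun k l => W (i, k) (j, l)
  have hq : ∀ b : Fin 3 → ℂ, ∑ i, ∑ j, Complex.normSq (star b ⬝ᵥ (S i j *ᵥ b)) ≤
      Complex.normSq (star b ⬝ᵥ ((∑ i, S i i) *ᵥ b)) := by
    intro b
    have hX : (Matrix.of fun i j => star b ⬝ᵥ (S i j *ᵥ b)).PosSemidef := by
      have hH : (Matrix.of fun i j => star b ⬝ᵥ (S i j *ᵥ b)).IsHermitian := by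
        ext i j
        have hS : (S j i)ᴴ = S i j := by
          ext k l
          exact hW.1.apply _ _
        simp only [Matrix.conjTranspose_apply, Matrix.of_apply]
        rw [Matrix.star_dotProduct, star_star, Matrix.star_mulVec, hS, Matrix.dotProduct_mulVec,
          dotProduct_comm]
      refine Matrix.PosSemidef.of_dotProduct_mulVec_nonneg hH fun a => ?_
      refine Complex.le_def.2 ⟨(hW.2 a b).trans_eq ?_, (hH.im_star_dotProduct_mulVec_self a).symm⟩
      congr 1
      simp [dotProduct, Matrix.mulVec, S, Fintype.sum_prod_type, Fin.sum_univ_three]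
      ring
    refine hX.sum_normSq_le.trans_eq ?_
    congr 1
    rw [Matrix.sum_mulVec, dotProduct_sum]
    rfl
  have h1 := Finset.sum_le_sum fun (s : Fin 4) (_ : s ∈ Finset.univ) =>
    Finset.sum_le_sum fun (t : Fin 4) (_ : t ∈ Finset.univ) =>
      hq ![1, Complex.I ^ (s : ℕ), Complex.I ^ (t : ℕ)]
  have h2 := Finset.sum_le_sum fun (k : Fin 3) (_ : k ∈ Finset.univ) => hq (Pi.single k 1)
  have h3 := add_le_add h1 (mul_le_mul_of_nonneg_left h2 (by norm_num : (0 : ℝ) ≤ 16))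
  rw [sum_normSq_quadForm_design] at h3
  have hcomm : ∀ (F : Fin 3 → Fin 3 → Fin 4 → Fin 4 → ℝ) (G : Fin 3 → Fin 3 → Fin 3 → ℝ),
      ∑ s, ∑ t, ∑ i, ∑ j, F i j s t + 16 * ∑ k, ∑ i, ∑ j, G i j k =
        ∑ i, ∑ j, (∑ s, ∑ t, F i j s t + 16 * ∑ k, G i j k) := by
    intro F G
    simp only [Fin.sum_univ_three, Finset.sum_add_distrib]
    ring
  rw [hcomm (fun i j s t => Complex.normSq (star ![1, Complex.I ^ (s : ℕ), Complex.I ^ (t : ℕ)] ⬝ᵥ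
        (S i j *ᵥ ![1, Complex.I ^ (s : ℕ), Complex.I ^ (t : ℕ)])))
      (fun i j k => Complex.normSq (star (Pi.single k 1) ⬝ᵥ (S i j *ᵥ Pi.single k 1)))] at h3
  simp only [sum_normSq_quadForm_design, ← Finset.mul_sum] at h3
  have htr : (∑ i, S i i).trace = W.trace := by
    simp [Matrix.trace, S, Fintype.sum_prod_type, Fin.sum_univ_three]
    ring
  have happ : ∀ k l, (∑ i, S i i) k l = ∑ i, W (i, k) (i, l) := fun k l => by
    simp [Matrix.sum_apply, S]
  simp only [htr, happ] at h3
  exact le_of_mul_le_mul_left h3 (by norm_num)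

/-- The Hilbert–Schmidt norm of a block positive matrix on `ℂ³ ⊗ ℂ³` is at most its trace. -/
theorem BlockPositive.sum_normSq_le {W : Matrix (Fin 3 × Fin 3) (Fin 3 × Fin 3) ℂ}
    (hW : BlockPositive W) :
    ∑ p, ∑ q, Complex.normSq (W p q) ≤ Complex.normSq W.trace := by
  have h1 := hW.sum_normSq_le_add
  have h2 := hW.swap.sum_normSq_le_add
  have htr : (W.submatrix Prod.swap Prod.swap).trace = W.trace := by
    simp only [Matrix.trace, Matrix.diag_apply, Matrix.submatrix_apply]
    exact Equiv.sum_comp (Equiv.prodComm _ _) fun p => W p p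
  rw [htr] at h2
  simp only [Matrix.submatrix_apply, Prod.swap_prod_mk, Fintype.sum_prod_type,
    Fin.sum_univ_three] at h1 h2 ⊢
  linarith

theorem BlockPositive.trace_eq_re {m n : ℕ} {W : Matrix (Fin m × Fin n) (Fin m × Fin n) ℂ}
    (hW : BlockPositive W) : W.trace = (W.trace.re : ℂ) ∧ 0 ≤ W.trace.re := by
  constructor
  · refine (Complex.conj_eq_iff_re.1 ?_).symm
    rw [← Complex.star_def, ← Matrix.trace_conjTranspose, hW.1.eq]
  · rw [Matrix.trace, Complex.re_sum]
    refine Finset.sum_nonneg fun p _ => ?_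
    have h := hW.2 (Pi.single p.1 1) (Pi.single p.2 1)
    have he : (fun q : Fin m × Fin n => (Pi.single p.1 1 : Fin m → ℂ) q.1 *
        (Pi.single p.2 1 : Fin n → ℂ) q.2) = Pi.single p 1 := by
      ext q
      simp [Pi.single_apply, Prod.ext_iff, ← ite_and, and_comm]
    rw [he] at h
    simpa using h

/-- Block positive matrices have nonnegative pairing with the ball around the identity. -/
theorem BlockPositive.re_trace_add_nonneg {W Δ : Matrix (Fin 3 × Fin 3) (Fin 3 × Fin 3) ℂ}
    (hW : BlockPositive W) (hΔ : ∑ p, ∑ q, Complex.normSq (Δ p q) ≤ 1) :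
    0 ≤ W.trace.re + (W * Δ).trace.re := by
  obtain ⟨htr, hpos⟩ := hW.trace_eq_re
  have hW2 := hW.sum_normSq_le
  rw [htr, Complex.normSq_ofReal] at hW2
  have hle : -(W * Δ).trace.re ≤ ∑ x : (Fin 3 × Fin 3) × (Fin 3 × Fin 3), ‖W x.1 x.2‖ * ‖Δ x.2 x.1‖ := by
    refine (neg_le_abs _).trans ((Complex.abs_re_le_norm _).trans ?_)
    have : (W * Δ).trace = ∑ x : (Fin 3 × Fin 3) × (Fin 3 × Fin 3), W x.1 x.2 * Δ x.2 x.1 := by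
      simp only [Matrix.trace, Matrix.diag_apply, Matrix.mul_apply]
      exact (Fintype.sum_prod_type fun x : (Fin 3 × Fin 3) × (Fin 3 × Fin 3) =>
        W x.1 x.2 * Δ x.2 x.1).symm
    rw [this]
    exact (norm_sum_le _ _).trans_eq (by simp only [norm_mul])
  have hcs := Finset.sum_mul_sq_le_sq_mul_sq Finset.univ
    (fun x : (Fin 3 × Fin 3) × (Fin 3 × Fin 3) => ‖W x.1 x.2‖) fun x => ‖Δ x.2 x.1‖
  have e1 : ∑ x : (Fin 3 × Fin 3) × (Fin 3 × Fin 3), ‖W x.1 x.2‖ ^ 2 =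
      ∑ p, ∑ q, Complex.normSq (W p q) := by
    rw [Fintype.sum_prod_type]
    simp only [Complex.normSq_eq_norm_sq]
  have e2 : ∑ x : (Fin 3 × Fin 3) × (Fin 3 × Fin 3), ‖Δ x.2 x.1‖ ^ 2 =
      ∑ p, ∑ q, Complex.normSq (Δ p q) := by
    rw [Fintype.sum_prod_type_right]
    simp only [Complex.normSq_eq_norm_sq]
  rw [e1, e2] at hcs
  have hΔ0 : 0 ≤ ∑ p, ∑ q, Complex.normSq (Δ p q) :=
    Finset.sum_nonneg fun p _ => Finset.sum_nonneg fun q _ => Complex.normSq_nonneg _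
  have hsq := hcs.trans (mul_le_mul hW2 hΔ hΔ0 (mul_self_nonneg _))
  rw [mul_one, ← sq] at hsq
  linarith [le_of_sq_le_sq hsq hpos]

theorem trace_vecMulVec_star_mul {m n : ℕ} (a : EuclideanSpace ℂ (Fin m))
    (b : EuclideanSpace ℂ (Fin n)) :
    (Matrix.vecMulVec (fun p : Fin m × Fin n => a p.1 * b p.2) (star fun p => a p.1 * b p.2)).trace =
      ((‖a‖ ^ 2 * ‖b‖ ^ 2 : ℝ) : ℂ) := by
  rw [EuclideanSpace.norm_sq_eq, EuclideanSpace.norm_sq_eq, Finset.sum_mul_sum,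
    ← Fintype.sum_prod_type']
  simp only [Matrix.trace, Matrix.diag_apply, Matrix.vecMulVec_apply, Complex.ofReal_sum]
  refine Finset.sum_congr rfl fun p _ => ?_
  rw [← mul_pow, ← norm_mul, Pi.star_apply, Complex.star_def, Complex.mul_conj,
    Complex.normSq_eq_norm_sq]

theorem trace_mul_vecMulVec_star {ι : Type*} [Fintype ι] (W : Matrix ι ι ℂ) (x : ι → ℂ) :
    (W * Matrix.vecMulVec x (star x)).trace = star x ⬝ᵥ (W *ᵥ x) := by
  rw [Matrix.mul_vecMulVec, Matrix.trace_vecMulVec, dotProduct_comm]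

/-- A Hermitian matrix of trace one which pairs nonnegatively with all block positive matrices is
separable. -/
theorem separable_of_blockPositive_pairing {m n : ℕ} {σ : Matrix (Fin m × Fin n) (Fin m × Fin n) ℂ}
    (hσ : σ.IsHermitian) (htr : σ.trace = 1)
    (h : ∀ W, BlockPositive W → 0 ≤ (W * σ).trace.re) : Separable σ := by
  let prodProj : EuclideanSpace ℂ (Fin m) × EuclideanSpace ℂ (Fin n) →
      Matrix (Fin m × Fin n) (Fin m × Fin n) ℂ := fun z =>
    Matrix.vecMulVec (fun p => z.1 p.1 * z.2 p.2) (star fun p => z.1 p.1 * z.2 p.2)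
  let K := prodProj '' (Metric.sphere 0 1 ×ˢ Metric.sphere 0 1)
  have hK : IsCompact K := by
    refine ((isCompact_sphere _ _).prod (isCompact_sphere _ _)).image ?_
    refine continuous_matrix fun p q => ?_
    simp only [prodProj, Matrix.vecMulVec_apply, Pi.star_apply]
    fun_prop
  by_cases hmem : σ ∈ convexHull ℝ K
  · obtain ⟨ι, _, w, z, hw, hw1, hz, rfl⟩ := mem_convexHull_iff_exists_fintype.1 hmem
    choose x hx hxz using hz
    let e := (Fintype.equivFin ι).symm
    refine ⟨Fintype.card ι,
      fun i => w (e i) • Matrix.vecMulVec (x (e i)).1 (star (x (e i)).1 : Fin m → ℂ),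
      fun i => Matrix.vecMulVec (x (e i)).2 (star (x (e i)).2 : Fin n → ℂ), fun i => ?_, fun i => ?_, ?_⟩
    · exact (Matrix.posSemidef_vecMulVec_self_star _).smul (hw _)
    · exact Matrix.posSemidef_vecMulVec_self_star _
    · rw [← e.sum_comp]
      refine Finset.sum_congr rfl fun i _ => ?_
      rw [← hxz]
      ext p q
      simp [prodProj, Matrix.vecMulVec_apply]
      ring
  · exfalso
    have : LocallyConvexSpace ℝ (Matrix (Fin m × Fin n) (Fin m × Fin n) ℂ) :=
      inferInstanceAs (LocallyConvexSpace ℝ ((Fin m × Fin n) → (Fin m × Fin n) → ℂ))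
    obtain ⟨f, u, hfσ, hfK⟩ := RCLike.geometric_hahn_banach_point_closed (𝕜 := ℂ)
      (convex_convexHull ℝ K) hK.convexHull_of_finiteDimensional.isClosed hmem
    let W₀ : Matrix (Fin m × Fin n) (Fin m × Fin n) ℂ :=
      Matrix.of fun p q => f (Matrix.single q p 1)
    have hf : ∀ X, f X = (W₀ * X).trace := by
      intro X
      conv_lhs => rw [Matrix.matrix_eq_sum_single X]
      simp only [map_sum, Matrix.trace, Matrix.diag_apply, Matrix.mul_apply, W₀, Matrix.of_apply]
      rw [Finset.sum_comm]
      refine Finset.sum_congr rfl fun p _ => Finset.sum_congr rfl fun q _ => ?_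
      rw [← mul_one (X q p), ← smul_eq_mul, ← Matrix.smul_single, map_smul, smul_eq_mul, mul_comm]
      simp
    let W₁ := W₀ - (u : ℂ) • (1 : Matrix (Fin m × Fin n) (Fin m × Fin n) ℂ)
    have hpair : ∀ X : Matrix (Fin m × Fin n) (Fin m × Fin n) ℂ, X.IsHermitian →
        ((W₁ + W₁ᴴ) * X).trace.re = 2 * ((f X).re - u * X.trace.re) := by
      intro X hX
      have h1 : (W₁ᴴ * X).trace = star (W₁ * X).trace := by
        rw [← Matrix.trace_conjTranspose, Matrix.conjTranspose_mul, hX.eq, Matrix.trace_mul_comm]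
      rw [Matrix.add_mul, Matrix.trace_add, h1, hf]
      simp only [W₁, Matrix.sub_mul, Matrix.trace_sub, Matrix.smul_mul, Matrix.one_mul,
        Matrix.trace_smul, smul_eq_mul, Complex.add_re, Complex.sub_re, Complex.star_def,
        Complex.conj_re, Complex.re_ofReal_mul]
      ring
    have hW : BlockPositive (W₁ + W₁ᴴ) := by
      refine ⟨Matrix.isHermitian_add_transpose_self _, fun a b => ?_⟩
      rw [← trace_mul_vecMulVec_star,
        hpair _ (Matrix.posSemidef_vecMulVec_self_star _).isHermitian]
      change 0 ≤ 2 * ((f (prodProj (WithLp.toLp 2 a, WithLp.toLp 2 b))).re -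
        u * (prodProj (WithLp.toLp 2 a, WithLp.toLp 2 b)).trace.re)
      generalize WithLp.toLp 2 a = x
      generalize WithLp.toLp 2 b = y
      by_cases hxy : x = 0 ∨ y = 0
      · have h0 : prodProj (x, y) = 0 := by
          ext p q
          rcases hxy with rfl | rfl <;> simp [prodProj, Matrix.vecMulVec_apply]
        simp [h0]
      · obtain ⟨hx, hy⟩ := not_or.1 hxy
        have hx' := norm_ne_zero_iff.2 hx
        have hy' := norm_ne_zero_iff.2 hy
        have hmem : prodProj ((‖x‖⁻¹ : ℂ) • x, (‖y‖⁻¹ : ℂ) • y) ∈ K := by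
          refine ⟨_, ⟨?_, ?_⟩, rfl⟩ <;> simp [norm_smul, hx', hy']
        have hscale : prodProj (x, y) = ((‖x‖ ^ 2 * ‖y‖ ^ 2 : ℝ) : ℂ) •
            prodProj ((‖x‖⁻¹ : ℂ) • x, (‖y‖⁻¹ : ℂ) • y) := by
          have hxC : (‖x‖ : ℂ) ≠ 0 := Complex.ofReal_ne_zero.2 hx'
          have hyC : (‖y‖ : ℂ) ≠ 0 := Complex.ofReal_ne_zero.2 hy'
          ext p q
          simp [prodProj, Matrix.vecMulVec_apply]
          field_simp
        have htrace : (prodProj (x, y)).trace = ((‖x‖ ^ 2 * ‖y‖ ^ 2 : ℝ) : ℂ) :=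
          trace_vecMulVec_star_mul x y
        rw [htrace, hscale, map_smul, smul_eq_mul, Complex.re_ofReal_mul, Complex.ofReal_re]
        have hu : u < (f _).re := hfK _ (subset_convexHull ℝ K hmem)
        have hpos : 0 ≤ ‖x‖ ^ 2 * ‖y‖ ^ 2 := by positivity
        linarith [mul_le_mul_of_nonneg_left hu.le hpos]
    have := h _ hW
    rw [hpair _ hσ, htr] at this
    simp at this hfσ
    linarith

theorem conj_unitary_smul_one_add {ι : Type*} [Fintype ι] [DecidableEq ι] {U : Matrix ι ι ℂ}
    (hU : U ∈ Matrix.unitaryGroup ι ℂ) (b d : ℂ) (P : Matrix ι ι ℂ) :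
    U * (b • 1 + d • P) * Uᴴ = b • 1 + d • (U * P * Uᴴ) := by
  have h : U * Uᴴ = 1 := Matrix.mem_unitaryGroup_iff.1 hU
  simp [Matrix.mul_add, Matrix.add_mul, h]

theorem projection_conj_unitary {ι : Type*} [Fintype ι] [DecidableEq ι] {U P : Matrix ι ι ℂ}
    (hU : U ∈ Matrix.unitaryGroup ι ℂ) (hP : P.IsHermitian) (hP2 : P * P = P) :
    (U * P * Uᴴ).IsHermitian ∧ U * P * Uᴴ * (U * P * Uᴴ) = U * P * Uᴴ ∧
      (U * P * Uᴴ).trace = P.trace := by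
  have h : Uᴴ * U = 1 := Matrix.mem_unitaryGroup_iff'.1 hU
  refine ⟨Matrix.isHermitian_mul_mul_conjTranspose _ hP, ?_, ?_⟩
  · calc U * P * Uᴴ * (U * P * Uᴴ) = U * P * (Uᴴ * U) * (P * Uᴴ) := by simp only [Matrix.mul_assoc]
      _ = U * (P * P) * Uᴴ := by rw [h, Matrix.mul_one]; simp only [Matrix.mul_assoc]
      _ = U * P * Uᴴ := by rw [hP2]
  · rw [Matrix.trace_mul_comm, ← Matrix.mul_assoc, h, Matrix.one_mul]

theorem Matrix.IsHermitian.sum_normSq_eq {ι : Type*} [Fintype ι] {X : Matrix ι ι ℂ}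
    (hX : X.IsHermitian) : ∑ p, ∑ q, Complex.normSq (X p q) = (X * X).trace.re := by
  simp only [Matrix.trace, Matrix.diag_apply, Matrix.mul_apply, Complex.re_sum]
  refine Finset.sum_congr rfl fun p _ => Finset.sum_congr rfl fun q _ => ?_
  rw [← hX.apply q p, Complex.star_def, Complex.mul_conj, Complex.ofReal_re]

theorem separable_of_projection {P : Matrix (Fin 3 × Fin 3) (Fin 3 × Fin 3) ℂ}
    (hP : P.IsHermitian) (hP2 : P * P = P) (htr : P.trace = 4) {b d : ℝ} (hbd : 9 * b + 4 * d = 1)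
    (hle : 9 * (8 * b - 1) ^ 2 + 4 * (16 * d * (8 * b - 1) + 64 * d ^ 2) ≤ 1) :
    Separable ((b : ℂ) • 1 + (d : ℂ) • P) := by
  have hH : ∀ x y : ℝ, ((x : ℂ) • (1 : Matrix (Fin 3 × Fin 3) (Fin 3 × Fin 3) ℂ) +
      (y : ℂ) • P).IsHermitian := fun x y =>
    (Matrix.isHermitian_one.smul (Complex.conj_ofReal x)).add (hP.smul (Complex.conj_ofReal y))
  have htr1 : (1 : Matrix (Fin 3 × Fin 3) (Fin 3 × Fin 3) ℂ).trace = 9 := by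
    rw [Matrix.trace_one]
    norm_num
  refine separable_of_blockPositive_pairing (hH b d) ?_ fun W hW => ?_
  · rw [Matrix.trace_add, Matrix.trace_smul, Matrix.trace_smul, htr, htr1, smul_eq_mul, smul_eq_mul]
    have : ((9 * b + 4 * d : ℝ) : ℂ) = 1 := by rw [hbd, Complex.ofReal_one]
    push_cast at this
    linear_combination this
  · have hΔ : ∑ p, ∑ q, Complex.normSq (((((8 * b - 1 : ℝ) : ℂ) •
        (1 : Matrix (Fin 3 × Fin 3) (Fin 3 × Fin 3) ℂ) + ((8 * d : ℝ) : ℂ) • P)) p q) ≤ 1 := by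
      rw [(hH _ _).sum_normSq_eq]
      refine le_of_eq_of_le ?_ hle
      simp only [Matrix.mul_add, Matrix.add_mul, Matrix.smul_mul, Matrix.mul_smul, Matrix.mul_one,
        Matrix.one_mul, hP2, Matrix.trace_add, Matrix.trace_smul, htr, htr1, smul_eq_mul,
        Complex.add_re, Complex.re_ofReal_mul]
      norm_num
      ring
    have h := hW.re_trace_add_nonneg hΔ
    simp only [Matrix.mul_add, Matrix.mul_smul, Matrix.mul_one, Matrix.trace_add,
      Matrix.trace_smul, smul_eq_mul, Complex.add_re, Complex.re_ofReal_mul] at h ⊢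
    linarith
/-- For the state `ρ` arising from an unextendible product basis in `ℂ³ ⊗ ℂ³` (five mutually
orthogonal product unit vectors), the mixture `ρ_p = (p/9)·I + (1-p)·ρ` is absolutely PPT
iff `p ≥ 9(10 - √17)/83`, and it is absolutely separable if `p ≥ 1 - 1/√10`. -/
theorem upb_state_absPPT_iff_and_absSep (v : Fin 5 → (Fin 3 × Fin 3 → ℂ))
    (horth : ∀ i j, (∑ q, star (v i q) * v j q) = if i = j then (1 : ℂ) else 0)
    (hprod : ∀ i, ∃ a b : Fin 3 → ℂ, v i = fun q => a q.1 * b q.2)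
    (p : ℝ) (hp₀ : 0 ≤ p) (hp₁ : p ≤ 1)
    (ρ : Matrix (Fin 3 × Fin 3) (Fin 3 × Fin 3) ℂ)
    (hρdef : ρ = ((1 / 4 : ℝ) : ℂ) •
        ((1 : Matrix (Fin 3 × Fin 3) (Fin 3 × Fin 3) ℂ)
          - ∑ i, Matrix.vecMulVec (v i) (star (v i))))
    (ρp : Matrix (Fin 3 × Fin 3) (Fin 3 × Fin 3) ℂ)
    (hρpdef : ρp = ((p / 9 : ℝ) : ℂ) • (1 : Matrix (Fin 3 × Fin 3) (Fin 3 × Fin 3) ℂ)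
        + ((1 - p : ℝ) : ℂ) • ρ) :
    (AbsolutelyPPT ρp ↔ 9 * (10 - Real.sqrt 17) / 83 ≤ p) ∧
    (1 - 1 / Real.sqrt 10 ≤ p → AbsolutelySeparable ρp) := by
  set P := (1 : Matrix (Fin 3 × Fin 3) (Fin 3 × Fin 3) ℂ) -
    ∑ i, Matrix.vecMulVec (v i) (star (v i)) with hPdef
  have hρ : ρp = ((p / 9 : ℝ) : ℂ) • 1 + (((1 - p) / 4 : ℝ) : ℂ) • P := by
    rw [hρpdef, hρdef, smul_smul, ← Complex.ofReal_mul]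
    congr 3
    ring
  have hv : ∀ i j, star (v i) ⬝ᵥ v j = if i = j then 1 else 0 := horth
  have hPH : P.IsHermitian := Matrix.isHermitian_one.sub (sum_vecMulVec_isHermitian v)
  have hP2 : P * P = P := by
    have h := sum_vecMulVec_mul_self hv
    rw [hPdef, Matrix.sub_mul, Matrix.mul_sub, Matrix.mul_sub, h]
    simp
  have hPtr : P.trace = 4 := by
    rw [hPdef, Matrix.trace_sub, trace_sum_vecMulVec hv, Matrix.trace_one]
    norm_num
  rw [hρ]
  have hd : 0 ≤ (1 - p) / 4 := by linarith
  have h17 : Real.sqrt 17 ^ 2 = 17 := Real.sq_sqrt (by norm_num)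
  have h4 : 4 < Real.sqrt 17 := Real.lt_sqrt_of_sq_lt (by norm_num)
  have h5 : Real.sqrt 17 < 5 := (Real.sqrt_lt' (by norm_num)).2 (by norm_num)
  refine ⟨⟨fun h => ?_, fun h U hU => ?_⟩, fun h U hU => ?_⟩
  · have hle := le_of_absolutelyPPT hv h 2 (Real.sqrt 17 - 3)
    nlinarith
  · obtain ⟨hH, h2, htr⟩ := projection_conj_unitary hU hPH hP2
    rw [conj_unitary_smul_one_add hU]
    refine partialTranspose_posSemidef_of_projection hH h2 (htr.trans hPtr) hd
      (τ := (Real.sqrt 17 - 1) / 4) (by linarith) (by nlinarith) (by nlinarith)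
  · obtain ⟨hH, h2, htr⟩ := projection_conj_unitary hU hPH hP2
    rw [conj_unitary_smul_one_add hU]
    refine separable_of_projection hH h2 (htr.trans hPtr) (by ring) ?_
    have h10 : Real.sqrt 10 ^ 2 = 10 := Real.sq_sqrt (by norm_num)
    have h10p : 0 < Real.sqrt 10 := Real.sqrt_pos.2 (by norm_num)
    have hr : (1 - p) ^ 2 ≤ 1 / 10 := by
      have : (1 - p) ^ 2 ≤ (1 / Real.sqrt 10) ^ 2 := pow_le_pow_left₀ (by linarith) (by linarith) 2
      rwa [div_pow, h10, one_pow] at this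
    nlinarith

end
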